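/- The double integral ∫₀^{2π} ∫_{−π/2}^{π/2} ρ₀(θ, φ) · sin θ · cos θ dθ dφ is strictly negative, where ρ₀(θ,φ) = ((π/2 − θ)⁴ sin²φ − (π/2 + θ)⁴ cos²φ) / ((π/2 + θ)⁴ cos²φ + (π/2 − θ)⁴ sin²φ). (This strict negativity, established in the proof of Lemma 4.7 — numerically the integral equals −4.6335890… — yields by dominated convergence that ∂M₃(K(c,d))/∂d at d = 0 is negative for all sufficiently small c > 0, which is the key sign used in the centering argument.) -/

import Mathlib

open Real MeasureTheory

/-- The pointwise limit `ρ₀` of `ρ_c` as `c → 0⁺`. -/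
noncomputable def rho0 (θ φ : ℝ) : ℝ :=
  ((π/2 - θ)^4 * sin φ ^ 2 - (π/2 + θ)^4 * cos φ ^ 2) /
    ((π/2 + θ)^4 * cos φ ^ 2 + (π/2 - θ)^4 * sin φ ^ 2)

lemma abs_rho0_le_one (θ φ : ℝ) : |rho0 θ φ| ≤ 1 := by
  have hx : 0 ≤ (π/2 - θ)^4 * sin φ ^ 2 := by positivity
  have hy : 0 ≤ (π/2 + θ)^4 * cos φ ^ 2 := by positivity
  rw [rho0, abs_div]
  refine div_le_one_of_le₀ ?_ (abs_nonneg _)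
  rw [abs_of_nonneg (add_nonneg hy hx), abs_le]
  constructor <;> linarith

lemma norm_rho0_mul_sin_mul_cos_le_one (θ φ : ℝ) : ‖rho0 θ φ * sin θ * cos θ‖ ≤ 1 := by
  rw [norm_mul, norm_mul, norm_eq_abs, norm_eq_abs, norm_eq_abs]
  exact mul_le_one₀ (mul_le_one₀ (abs_rho0_le_one θ φ) (abs_nonneg _) (abs_sin_le_one θ))
    (abs_nonneg _) (abs_cos_le_one θ)

lemma measurable_rho0_mul_sin_mul_cos (φ : ℝ) :
    Measurable fun θ ↦ rho0 θ φ * sin θ * cos θ := by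
  unfold rho0
  fun_prop

lemma rho0_denom_pos {θ : ℝ} (h₁ : -(π/2) < θ) (h₂ : θ < π/2) (φ : ℝ) :
    0 < (π/2 + θ)^4 * cos φ ^ 2 + (π/2 - θ)^4 * sin φ ^ 2 := by
  have hB : 0 < (π/2 + θ)^4 := pow_pos (by linarith) 4
  have hA : 0 < (π/2 - θ)^4 := pow_pos (by linarith) 4
  rcases eq_or_ne (sin φ) 0 with h | h
  · have hc : cos φ ^ 2 = 1 := by nlinarith [sin_sq_add_cos_sq φ]
    rw [h, hc]
    simpa using hB
  · have : 0 < sin φ ^ 2 := by positivity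
    positivity

lemma intervalIntegrable_rho0_mul_sin_mul_cos (φ a b : ℝ) :
    IntervalIntegrable (fun θ ↦ rho0 θ φ * sin θ * cos θ) volume a b :=
  (intervalIntegrable_const (c := (1 : ℝ))).mono_fun
    (measurable_rho0_mul_sin_mul_cos φ).aestronglyMeasurable
    (Filter.Eventually.of_forall fun θ ↦ by
      simpa using norm_rho0_mul_sin_mul_cos_le_one θ φ)

lemma continuous_integral_rho0_mul_sin_mul_cos :
    Continuous fun φ ↦ ∫ θ in (-(π/2))..(π/2), rho0 θ φ * sin θ * cos θ := by
  refine intervalIntegral.continuous_of_dominated_interval (bound := fun _ ↦ 1)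
    (fun φ ↦ (measurable_rho0_mul_sin_mul_cos φ).aestronglyMeasurable)
    (fun φ ↦ Filter.Eventually.of_forall fun θ _ ↦ norm_rho0_mul_sin_mul_cos_le_one θ φ)
    intervalIntegrable_const ?_
  filter_upwards [Measure.ae_ne volume (π/2)] with θ hne hθ
  rw [Set.uIoc_of_le (by linarith [pi_pos])] at hθ
  have hd := fun φ ↦ (rho0_denom_pos hθ.1 (lt_of_le_of_ne hθ.2 hne) φ).ne'
  unfold rho0
  fun_prop (disch := exact hd _)

lemma rho0_sub_rho0_neg {θ : ℝ} (h₁ : -(π/2) < θ) (h₂ : θ < π/2) (φ : ℝ) :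
    rho0 θ φ - rho0 (-θ) φ =
      2 * sin φ ^ 2 * cos φ ^ 2 * (((π/2 - θ)^4)^2 - ((π/2 + θ)^4)^2) /
        (((π/2 + θ)^4 * cos φ ^ 2 + (π/2 - θ)^4 * sin φ ^ 2) *
          ((π/2 + -θ)^4 * cos φ ^ 2 + (π/2 - -θ)^4 * sin φ ^ 2)) := by
  have hd := (rho0_denom_pos h₁ h₂ φ).ne'
  have hd' := (rho0_denom_pos (θ := -θ) (by linarith) (by linarith) φ).ne'
  rw [rho0, rho0, div_sub_div _ _ hd hd']
  congr 1
  ring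

lemma rho0_le_rho0_neg {θ : ℝ} (h₀ : 0 ≤ θ) (h₂ : θ < π/2) (φ : ℝ) :
    rho0 θ φ ≤ rho0 (-θ) φ := by
  have h₁ : -(π/2) < θ := by linarith [pi_pos]
  rw [← sub_nonpos, rho0_sub_rho0_neg h₁ h₂]
  have hd := rho0_denom_pos h₁ h₂ φ
  have hd' := rho0_denom_pos (θ := -θ) (by linarith) (by linarith) φ
  have hAB : ((π/2 - θ)^4)^2 ≤ ((π/2 + θ)^4)^2 := by
    have : 0 ≤ π/2 - θ := by linarith
    gcongr
    linarith
  exact div_nonpos_of_nonpos_of_nonneg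
    (mul_nonpos_of_nonneg_of_nonpos (by positivity) (sub_nonpos.2 hAB)) (mul_pos hd hd').le

lemma rho0_mul_sin_mul_cos_add_neg_nonpos {θ : ℝ} (hθ : θ ∈ Set.Icc (-(π/2)) (π/2)) (φ : ℝ) :
    rho0 θ φ * sin θ * cos θ + rho0 (-θ) φ * sin (-θ) * cos (-θ) ≤ 0 := by
  have key : ∀ t : ℝ, 0 ≤ t → t ≤ π/2 →
      rho0 t φ * sin t * cos t + rho0 (-t) φ * sin (-t) * cos (-t) ≤ 0 := by
    intro t h₀ h₁
    rcases h₁.eq_or_lt with rfl | h₁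
    · simp
    · have hs : 0 ≤ sin t := sin_nonneg_of_nonneg_of_le_pi h₀ (by linarith)
      have hc : 0 ≤ cos t := cos_nonneg_of_neg_pi_div_two_le_of_le (by linarith) h₁.le
      have := mul_nonneg (sub_nonneg.2 (rho0_le_rho0_neg h₀ h₁ φ)) (mul_nonneg hs hc)
      rw [sin_neg, cos_neg]
      linarith
  rcases le_total 0 θ with h | h
  · exact key θ h hθ.2
  · have := key (-θ) (by linarith) (by linarith [hθ.1])
    rw [neg_neg] at this
    linarith

lemma integral_rho0_mul_sin_mul_cos_nonpos (φ : ℝ) :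
    ∫ θ in (-(π/2))..(π/2), rho0 θ φ * sin θ * cos θ ≤ 0 := by
  have hflip := intervalIntegral.integral_comp_neg (a := -(π/2)) (b := π/2)
    fun θ ↦ rho0 θ φ * sin θ * cos θ
  have hf := intervalIntegrable_rho0_mul_sin_mul_cos φ (-(π/2)) (π/2)
  have hf_neg : IntervalIntegrable (fun θ ↦ rho0 (-θ) φ * sin (-θ) * cos (-θ)) volume
      (-(π/2)) (π/2) := by
    simpa using (IntervalIntegrable.iff_comp_neg enorm_ne_top).1
      (intervalIntegrable_rho0_mul_sin_mul_cos φ (π/2) (-(π/2)))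
  rw [neg_neg] at hflip
  have hsum := intervalIntegral.integral_add hf hf_neg
  have hle : 0 ≤ ∫ θ in (-(π/2))..(π/2),
      -(rho0 θ φ * sin θ * cos θ + rho0 (-θ) φ * sin (-θ) * cos (-θ)) :=
    intervalIntegral.integral_nonneg (by linarith [pi_pos]) fun θ hθ ↦
      neg_nonneg.2 (rho0_mul_sin_mul_cos_add_neg_nonpos hθ φ)
  rw [intervalIntegral.integral_neg] at hle
  linarith

lemma rho0_pi_div_four (θ : ℝ) :
    rho0 θ (π/4) = ((π/2 - θ)^4 - (π/2 + θ)^4) / ((π/2 + θ)^4 + (π/2 - θ)^4) := by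
  have h : (√2 / 2) ^ 2 = (1 / 2 : ℝ) := by
    rw [div_pow, sq_sqrt zero_le_two]; norm_num
  rw [rho0, sin_pi_div_four, cos_pi_div_four, h, ← sub_mul, ← add_mul]
  exact mul_div_mul_right _ _ (by norm_num)

lemma integral_rho0_pi_div_four_mul_sin_mul_cos_neg :
    ∫ θ in (-(π/2))..(π/2), rho0 θ (π/4) * sin θ * cos θ < 0 := by
  have hpi := pi_pos
  have hd : ∀ θ : ℝ, 0 < (π/2 + θ)^4 + (π/2 - θ)^4 := fun θ ↦ by
    nlinarith [sq_nonneg ((π/2 + θ)^2 - (π/2 - θ)^2), sq_nonneg θ, pow_pos hpi 4,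
      sq_nonneg (π * θ), sq_nonneg (θ ^ 2)]
  have hrho : ∀ θ : ℝ, rho0 θ (π/4) =
      -(θ * (4 * π * ((π/2)^2 + θ^2) / ((π/2 + θ)^4 + (π/2 - θ)^4))) := fun θ ↦ by
    rw [rho0_pi_div_four, mul_div_assoc', ← neg_div]
    congr 1
    ring
  have hq : ∀ θ : ℝ, 0 < 4 * π * ((π/2)^2 + θ^2) / ((π/2 + θ)^4 + (π/2 - θ)^4) := fun θ ↦
    div_pos (by positivity) (hd θ)
  rw [← neg_pos, ← intervalIntegral.integral_neg]
  refine intervalIntegral.integral_pos (by linarith) ?_ (fun θ hθ ↦ ?_)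
    ⟨π/4, ⟨by linarith, by linarith⟩, ?_⟩
  · simp only [rho0_pi_div_four]
    have hd' := fun θ ↦ (hd θ).ne'
    fun_prop (disch := intros; exact hd' _)
  · have hc : 0 ≤ cos θ := cos_nonneg_of_neg_pi_div_two_le_of_le hθ.1.le hθ.2
    have hs : 0 ≤ θ * sin θ := by
      rcases le_total 0 θ with h | h
      · exact mul_nonneg h (sin_nonneg_of_nonneg_of_le_pi h (by linarith [hθ.2]))
      · exact mul_nonneg_of_nonpos_of_nonpos h
          (sin_nonpos_of_nonpos_of_neg_pi_le h (by linarith [hθ.1]))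
    have := mul_nonneg (mul_nonneg hs hc) (hq θ).le
    rw [hrho]
    linarith
  · have hc : 0 < cos (π/4) := cos_pos_of_mem_Ioo ⟨by linarith, by linarith⟩
    have hs : 0 < sin (π/4) := sin_pos_of_pos_of_lt_pi (by linarith) (by linarith)
    have := mul_pos (mul_pos (mul_pos (show 0 < π/4 by linarith) hs) hc) (hq (π/4))
    rw [hrho]
    linarith

/-- The double integral `∫₀^{2π} ∫_{−π/2}^{π/2} ρ₀(θ,φ) sin θ cos θ dθ dφ` is strictly
negative (numerically it equals `(−4.6335890…)/(2π)`-fold of `2π`). -/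
theorem stmt_17 :
    (∫ φ in (0:ℝ)..(2*π), ∫ θ in (-(π/2))..(π/2), rho0 θ φ * sin θ * cos θ) < 0 := by
  have hpi := pi_pos
  rw [← neg_pos, ← intervalIntegral.integral_neg]
  exact intervalIntegral.integral_pos (by linarith)
    continuous_integral_rho0_mul_sin_mul_cos.neg.continuousOn
    (fun φ _ ↦ neg_nonneg.2 (integral_rho0_mul_sin_mul_cos_nonpos φ))
    ⟨π/4, ⟨by linarith, by linarith⟩, neg_pos.2 integral_rho0_pi_div_four_mul_sin_mul_cos_neg⟩
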